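/- arXiv:2003.04615 — 3 statements merged into one kernel-verified Lean document; each statement's English description precedes it below -/
import Mathlib

section
/- Assume a₀ is a positive integer whose Col₂-orbit a_α tends to infinity. Then liminf_{α→∞} c_α = 1, where c_α = 3^{-q_α}·a_α and q_α = ⌊log a_α / log 3⌋. -/
/-- The accelerated Collatz map `Col₂`: `(3a+1)/2` if `a` odd, `a/2` if `a` even. -/
def col2 (a : ℕ) : ℕ := if a % 2 = 1 then (3 * a + 1) / 2 else a / 2

/-- `q_α = ⌊log (a α) / log 3⌋`. -/
noncomputable def qseq (a : ℕ → ℕ) (α : ℕ) : ℤ := ⌊Real.log (a α) / Real.log 3⌋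

/-- `c_α = 3^{-q_α} · a_α`. -/
noncomputable def cseq (a : ℕ → ℕ) (α : ℕ) : ℝ := (3 : ℝ) ^ (-qseq a α) * (a α)

open Filter Topology in
theorem irr_aux : Irrational (Real.log 2 / Real.log 3) := by
  have h3 : 0 < Real.log 3 := Real.log_pos (by norm_num)
  have h2 : 0 < Real.log 2 := Real.log_pos (by norm_num)
  rintro ⟨r, hr⟩
  have hrpos : (0 : ℝ) < (r : ℝ) := by rw [hr]; positivity
  have hr0 : 0 < r := by exact_mod_cast hrpos
  have hnum : 0 < r.num := Rat.num_pos.mpr hr0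
  obtain ⟨m, hm⟩ := Int.eq_ofNat_of_zero_le hnum.le
  have hd : 0 < r.den := r.den_pos
  have hrr : (r : ℝ) = (m : ℝ) / (r.den : ℝ) := by
    rw [Rat.cast_def, hm]; simp
  rw [hrr] at hr
  have hd' : (r.den : ℝ) ≠ 0 := by positivity
  rw [div_eq_div_iff hd' h3.ne'] at hr
  have h : Real.log ((3 : ℝ) ^ m) = Real.log ((2 : ℝ) ^ r.den) := by
    rw [Real.log_pow, Real.log_pow]; linarith
  have h' : (3 : ℝ) ^ m = 2 ^ r.den :=
    Real.log_injOn_pos (Set.mem_Ioi.mpr (by positivity)) (Set.mem_Ioi.mpr (by positivity)) h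
  have h'' : 3 ^ m = 2 ^ r.den := by exact_mod_cast h'
  have e1 : Odd (3 ^ m) := Odd.pow (by decide)
  have e2 : Even (2 ^ r.den) := (even_two).pow_of_ne_zero hd.ne'
  rw [h''] at e1
  exact (Nat.not_even_iff_odd.mpr e1) e2

open Filter Topology in
theorem rot_aux (y : ℕ → AddCircle (1 : ℝ)) (θ : ℝ) (hθ : Irrational θ)
    (h : Tendsto (fun n => y (n + 1) - (y n - (θ : AddCircle (1 : ℝ)))) atTop (𝓝 0))
    (z : AddCircle (1 : ℝ)) : MapClusterPt z atTop y := by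
  have : Fact ((0 : ℝ) < 1) := ⟨one_pos⟩
  have step : ∀ z, MapClusterPt z atTop y → MapClusterPt (z + ((-θ : ℝ) : AddCircle (1:ℝ))) atTop y := by
    intro z hz
    rw [mapClusterPt_iff_ultrafilter] at hz
    obtain ⟨U, hU, hz⟩ := hz
    have h1 : Tendsto (y ∘ (fun n => n + 1)) U (𝓝 (z + ((-θ : ℝ) : AddCircle (1:ℝ)))) := by
      have := (h.mono_left hU).add (hz.sub_const (θ : AddCircle (1 : ℝ)))
      convert this using 1
      · ext n; simp
      · simp [sub_eq_add_neg]
    exact MapClusterPt.of_comp ((tendsto_add_atTop_nat 1).mono_left hU) h1.mapClusterPt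
  obtain ⟨z0, hz0⟩ : ∃ z0, MapClusterPt z0 atTop y := exists_clusterPt_of_compactSpace _
  have all : ∀ n : ℕ, MapClusterPt (z0 + n • ((-θ : ℝ) : AddCircle (1:ℝ))) atTop y := by
    intro n
    induction n with
    | zero => simpa using hz0
    | succ k ih =>
      have := step _ ih
      rwa [add_assoc, ← succ_nsmul] at this
  have hd : DenseRange (fun n : ℕ => n • ((-θ : ℝ) : AddCircle (1:ℝ))) := by
    rw [← denseRange_zsmul_iff_nsmul, AddCircle.denseRange_zsmul_coe_iff]
    simpa using hθ.neg
  have hcl : IsClosed {w | MapClusterPt (z0 + w) atTop y} := by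
    have : IsClosed {w | MapClusterPt w atTop y} := isClosed_setOfPred_clusterPt
    exact this.preimage (continuous_const_add z0)
  have := hd.induction_on (p := fun w => MapClusterPt (z0 + w) atTop y) (z - z0) hcl all
  simpa using this

open Filter Topology in
theorem liminf_cseq_eq_one (a : ℕ → ℕ) (ha0 : 1 ≤ a 0)
    (hrec : ∀ α : ℕ, a (α + 1) = col2 (a α))
    (hinf : Filter.Tendsto a Filter.atTop Filter.atTop) :
    Filter.liminf (fun α => cseq a α) Filter.atTop = 1 := by
  have h3 : 0 < Real.log 3 := Real.log_pos (by norm_num)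
  have h31 : 1 ≤ Real.log 3 := by
    rw [Real.le_log_iff_exp_le (by norm_num)]
    linarith [Real.exp_one_lt_d9]
  have hpos : ∀ n, 1 ≤ a n := by
    intro n
    induction n with
    | zero => exact ha0
    | succ k ih => rw [hrec, col2]; split_ifs <;> omega
  have hposR : ∀ n, (0 : ℝ) < a n := fun n => by exact_mod_cast hpos n
  set x : ℕ → ℝ := fun n => Real.log (a n) / Real.log 3 with hx
  have hax : ∀ n, (a n : ℝ) = (3 : ℝ) ^ (x n) := by
    intro n
    rw [Real.rpow_def_of_pos (by norm_num), hx]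
    simp only
    rw [mul_div_cancel₀ _ h3.ne', Real.exp_log (hposR n)]
  have hc : ∀ n, cseq a n = (3 : ℝ) ^ (Int.fract (x n)) := by
    intro n
    have : qseq a n = ⌊x n⌋ := rfl
    rw [cseq, this, hax n, ← Real.rpow_intCast, ← Real.rpow_add (by norm_num)]
    congr 1
    rw [Int.fract]; push_cast; ring
  have hstep : ∀ n, ∃ k : ℤ, 0 ≤ x (n+1) - (x n - Real.log 2 / Real.log 3) - k ∧
      x (n+1) - (x n - Real.log 2 / Real.log 3) - k ≤ 1 / (a n : ℝ) := by
    intro n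
    have hp := hposR n
    have hp1 := hposR (n+1)
    have hlog2 : Real.log (2 * a (n+1)) = Real.log 2 + Real.log (a (n+1)) :=
      Real.log_mul (by norm_num) hp1.ne'
    by_cases ho : a n % 2 = 1
    · refine ⟨1, ?_⟩
      have h2 : 2 * a (n+1) = 3 * a n + 1 := by
        rw [hrec, col2, if_pos ho]; omega
      have h2R : (2 * a (n+1) : ℝ) = (3 * a n) * (1 + 1 / (3 * a n)) := by
        have : (2 * a (n+1) : ℝ) = 3 * a n + 1 := by exact_mod_cast h2
        rw [this]; field_simp
      rw [h2R, Real.log_mul (by positivity) (by positivity),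
        Real.log_mul (by norm_num) hp.ne'] at hlog2
      have he : x (n+1) - (x n - Real.log 2 / Real.log 3) - ((1 : ℤ) : ℝ)
          = Real.log (1 + 1 / (3 * a n)) / Real.log 3 := by
        simp only [hx]
        have h4 : Real.log (1 + 1 / (3 * (a n : ℝ))) =
            Real.log 2 + Real.log (a (n+1)) - Real.log 3 - Real.log (a n) := by linarith
        rw [h4]
        field_simp
        push_cast
        ring
      rw [he]
      have hq : (0:ℝ) < 1 / (3 * a n) := by positivity
      have l0 : 0 ≤ Real.log (1 + 1 / (3 * a n)) := Real.log_nonneg (by linarith)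
      have l1 : Real.log (1 + 1 / (3 * a n)) ≤ 1 / (3 * a n) := by
        have := Real.log_le_sub_one_of_pos (x := 1 + 1 / (3 * (a n : ℝ))) (by positivity)
        linarith
      refine ⟨by positivity, ?_⟩
      calc _ ≤ Real.log (1 + 1 / (3 * a n)) := div_le_self l0 h31
        _ ≤ 1 / (3 * a n) := l1
        _ ≤ 1 / a n := one_div_le_one_div_of_le hp (by linarith)
    · refine ⟨0, ?_⟩
      have h2 : 2 * a (n+1) = a n := by
        rw [hrec, col2, if_neg ho]; omega
      have h2R : (2 * a (n+1) : ℝ) = a n := by exact_mod_cast h2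
      rw [h2R] at hlog2
      have he : x (n+1) - (x n - Real.log 2 / Real.log 3) - ((0 : ℤ) : ℝ) = 0 := by
        simp only [hx]
        rw [hlog2]
        push_cast
        ring
      rw [he]
      exact ⟨le_rfl, by positivity⟩
  choose k hk0 hk1 using hstep
  have he : Tendsto (fun n => x (n+1) - (x n - Real.log 2 / Real.log 3) - k n) atTop (𝓝 0) := by
    have hR : Tendsto (fun n => 1 / (a n : ℝ)) atTop (𝓝 0) := by
      simp only [one_div]
      exact tendsto_inv_atTop_zero.comp (tendsto_natCast_atTop_atTop.comp hinf)
    exact squeeze_zero hk0 hk1 hR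
  have key := rot_aux (fun n => (x n : AddCircle (1:ℝ))) (Real.log 2 / Real.log 3) irr_aux (by
    have := ((AddCircle.continuous_mk' (1:ℝ)).tendsto 0).comp he
    have hk : ∀ m : ℤ, ((m : ℝ) : AddCircle (1:ℝ)) = 0 := by
      intro m
      rw [AddCircle.coe_eq_zero_iff]
      exact ⟨m, by simp⟩
    convert this using 1
    · ext n
      simp [hk]
    · rw [map_zero])
  have hge : ∀ n, 1 ≤ cseq a n := fun n => by
    rw [hc]; exact Real.one_le_rpow (by norm_num) (Int.fract_nonneg _)
  have hle : ∀ n, cseq a n ≤ 3 := fun n => by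
    rw [hc]
    calc (3:ℝ) ^ Int.fract (x n) ≤ 3 ^ (1:ℝ) :=
          Real.rpow_le_rpow_of_exponent_le (by norm_num) (Int.fract_lt_one _).le
      _ = 3 := by simp
  have hb : IsBoundedUnder (· ≥ ·) atTop (fun n => cseq a n) :=
    isBoundedUnder_of ⟨1, hge⟩
  have hb' : IsBoundedUnder (· ≤ ·) atTop (fun n => cseq a n) :=
    isBoundedUnder_of ⟨3, hle⟩
  apply le_antisymm
  · have hδ : ∀ δ : ℝ, 0 < δ → δ < 1 → liminf (fun n => cseq a n) atTop ≤ 3 ^ δ := by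
      intro δ h0 h1
      apply liminf_le_of_frequently_le _ hb
      have hopen : (fun t : ℝ => (t : AddCircle (1:ℝ))) '' Set.Ioo 0 δ ∈
          𝓝 (((δ/2 : ℝ)) : AddCircle (1:ℝ)) := by
        apply (QuotientAddGroup.isOpenMap_coe _ isOpen_Ioo).mem_nhds
        exact ⟨δ/2, ⟨by linarith, by linarith⟩, rfl⟩
      refine (mapClusterPt_iff_frequently.mp (key _) _ hopen).mono ?_
      rintro n ⟨t, ⟨ht0, ht1⟩, ht⟩
      rw [hc]
      apply Real.rpow_le_rpow_of_exponent_le (by norm_num)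
      have : ((x n - t : ℝ) : AddCircle (1:ℝ)) = 0 := by
        simp only at ht
        rw [AddCircle.coe_sub, ht, sub_self]
      rw [AddCircle.coe_eq_zero_iff] at this
      obtain ⟨m, hm⟩ := this
      have hxn : x n = t + m := by
        simp at hm; linarith
      rw [hxn, Int.fract_add_intCast, Int.fract_eq_self.mpr ⟨ht0.le, by linarith⟩]
      exact ht1.le
    have ht : Tendsto (fun δ : ℝ => (3:ℝ) ^ δ) (𝓝[>] 0) (𝓝 1) := by
      have : Continuous (fun δ : ℝ => (3:ℝ) ^ δ) := Real.continuous_const_rpow (by norm_num)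
      have h := this.tendsto 0
      rw [Real.rpow_zero] at h
      exact h.mono_left nhdsWithin_le_nhds
    refine ge_of_tendsto ht ?_
    filter_upwards [Ioo_mem_nhdsGT (zero_lt_one (α := ℝ))] with δ hd
    exact hδ δ hd.1 hd.2
  · exact le_liminf_of_le hb'.isCoboundedUnder_ge (Eventually.of_forall hge)
end

section
/- For every nonzero b ∈ 𝐍 and every n ∈ ℕ, 2^{-n}·b ≤ Col₃ⁿ(b) ≤ 2^{-n}·b + 3^{-q(b)}, where q(b) = min{r ≥ 0 : 3^r·b ∈ ℕ}. -/
open scoped Classical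

/-- `𝐍 = ⋃_{r≥0} 3^{-r}·ℕ`, the nonnegative rationals whose denominator is a power of 3,
viewed inside `ℝ`. -/
def NN : Set ℝ := {b | ∃ r m : ℕ, b = (m : ℝ) / 3 ^ r}

/-- `q(b) = min {r ≥ 0 : 3^r·b ∈ ℕ}` (for `b ∈ 𝐍`). -/
noncomputable def qexp (b : ℝ) : ℕ := sInf {r : ℕ | ∃ m : ℕ, b = (m : ℝ) / 3 ^ r}

/-- `Col₃(b) = b/2` if `b/2 ∈ 𝐍`, and `(b + 3^{-q(b)-1})/2` otherwise. -/
noncomputable def col3 (b : ℝ) : ℝ :=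
  if b / 2 ∈ NN then b / 2 else (b + (3 : ℝ) ^ (-(qexp b : ℤ) - 1)) / 2

/-- `Col₄(b) = Col₃(b)` if `2 ≤ b < 3`, and `3·Col₃(b)` if `1 ≤ b < 2`. -/
noncomputable def col4 (b : ℝ) : ℝ := if 2 ≤ b then col3 b else 3 * col3 b

lemma qexp_spec {b : ℝ} (hb : b ∈ NN) : ∃ m : ℕ, b = (m : ℝ) / 3 ^ qexp b := by
  have : {r : ℕ | ∃ m : ℕ, b = (m : ℝ) / 3 ^ r}.Nonempty := hb
  exact Nat.sInf_mem this

lemma qexp_le {b : ℝ} (r m : ℕ) (h : b = (m : ℝ) / 3 ^ r) : qexp b ≤ r :=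
  Nat.sInf_le ⟨m, h⟩

lemma qexp_half {b : ℝ} (h : b / 2 ∈ NN) : qexp b ≤ qexp (b / 2) := by
  obtain ⟨m, hm⟩ := qexp_spec h
  apply qexp_le _ (2 * m)
  push_cast
  rw [mul_div_assoc, ← hm]; ring

lemma odd_step {b : ℝ} (hb : b ∈ NN) (h : b / 2 ∉ NN) :
    (b + (3 : ℝ) ^ (-(qexp b : ℤ) - 1)) / 2 ∈ NN ∧
    qexp b + 1 ≤ qexp ((b + (3 : ℝ) ^ (-(qexp b : ℤ) - 1)) / 2) := by
  have hz : (3 : ℝ) ^ (-(qexp b : ℤ) - 1) = 1 / 3 ^ (qexp b + 1) := by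
    rw [show (-(qexp b : ℤ) - 1) = -((qexp b + 1 : ℕ) : ℤ) by push_cast; ring, zpow_neg,
      zpow_natCast, one_div]
  obtain ⟨m, hm⟩ := qexp_spec hb
  rw [hz]
  generalize qexp b = q at *
  have hc : (b + 1 / 3 ^ (q + 1)) / 2 ∈ NN := by
    rcases Nat.even_or_odd' m with ⟨k, hk | hk⟩
    · exact absurd ⟨q, k, by rw [hm, hk]; push_cast; ring⟩ h
    · refine ⟨q + 1, 3 * k + 2, ?_⟩
      rw [hm, hk]; push_cast; field_simp; ring
  refine ⟨hc, ?_⟩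
  obtain ⟨k, hk⟩ := qexp_spec hc
  by_contra hlt
  generalize qexp ((b + 1 / 3 ^ (q + 1)) / 2) = r at *
  obtain ⟨d, rfl⟩ : ∃ d, q = r + d := ⟨q - r, by omega⟩
  have h1 : (3 * m + 1 : ℝ) = 3 * (2 * k * 3 ^ d) := by
    rw [hm] at hk
    field_simp at hk
    simp only [pow_add, pow_one] at hk
    have h3 : (3 : ℝ) ^ r ≠ 0 := by positivity
    have h4 : (3 : ℝ) ^ d ≠ 0 := by positivity
    field_simp at hk
    linarith
  have h2 : 3 * m + 1 = 3 * (2 * k * 3 ^ d) := by exact_mod_cast h1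
  omega

/-- For nonzero `b ∈ 𝐍` and every `n`, `2^{-n}·b ≤ Col₃ⁿ(b) ≤ 2^{-n}·b + 3^{-q(b)}`. -/
theorem col3_iterate_bounds (b : ℝ) (hb : b ∈ NN) (hb0 : b ≠ 0) (n : ℕ) :
    b / 2 ^ n ≤ col3^[n] b ∧ col3^[n] b ≤ b / 2 ^ n + (3 : ℝ) ^ (-(qexp b : ℤ)) := by
  clear hb0
  induction n generalizing b with
  | zero => simp
  | succ n ih =>
    rw [Function.iterate_succ_apply]
    have e : b / 2 ^ (n + 1) = b / 2 / 2 ^ n := by rw [pow_succ]; field_simp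
    rw [e]
    by_cases h : b / 2 ∈ NN
    · rw [show col3 b = b / 2 by simp [col3, h]]
      obtain ⟨h1, h2⟩ := ih _ h
      refine ⟨h1, h2.trans ?_⟩
      have := qexp_half h
      gcongr
      norm_num
    · rw [show col3 b = _ from if_neg h]
      obtain ⟨hc, hq⟩ := odd_step hb h
      obtain ⟨h1, h2⟩ := ih _ hc
      have hm : (3 : ℝ) ^ (-(qexp ((b + (3 : ℝ) ^ (-(qexp b : ℤ) - 1)) / 2) : ℤ)) ≤
          (3 : ℝ) ^ (-(qexp b : ℤ) - 1) :=
        zpow_le_zpow_right₀ (by norm_num) (by omega)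
      have h3 : (3 : ℝ) ^ (-(qexp b : ℤ)) = 3 * (3 : ℝ) ^ (-(qexp b : ℤ) - 1) := by
        rw [zpow_sub_one₀ (by norm_num)]; ring
      have hp : 0 < (3 : ℝ) ^ (-(qexp b : ℤ) - 1) := by positivity
      rw [h3]
      generalize (3 : ℝ) ^ (-(qexp b : ℤ) - 1) = t at *
      have e2 : (b + t) / 2 / 2 ^ n = b / 2 / 2 ^ n + t / 2 / 2 ^ n := by ring
      have h5 : t / 2 / 2 ^ n ≤ t / 2 :=
        div_le_self (by positivity) (one_le_pow₀ (by norm_num))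
      have h6 : 0 ≤ t / 2 / 2 ^ n := by positivity
      rw [e2] at h1 h2
      constructor <;> linarith
end

section
/- Assume a₀ is a positive integer whose Col₂-orbit a_α tends to infinity. Then for every positive integer φ there exists a strictly increasing sequence of indices α₁ < α₂ < α₃ < ⋯ such that φ ≼ a_{α₁} and a_{α_i} ≼ a_{α_{i+1}} for all i, i.e. the subsequence (a_{α_i}) is ≼-increasing and minored by φ. -/
/-- `φ ≼ θ` iff `φ = ⌊3^{p-q}·θ⌋` with `p = ⌊log φ / log 3⌋`, `q = ⌊log θ / log 3⌋`,
i.e. the base-3 digits of `φ` are the leading base-3 digits of `θ`. -/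
def prec3 (φ θ : ℕ) : Prop :=
  (φ : ℤ) = ⌊(3 : ℝ) ^ (⌊Real.log φ / Real.log 3⌋ - ⌊Real.log θ / Real.log 3⌋) * θ⌋

open Filter Topology in
lemma tendsto_step (a : ℕ → ℕ) (hpos : ∀ n, 1 ≤ a n)
    (hrec : ∀ α : ℕ, a (α + 1) = col2 (a α))
    (hinf : Tendsto a atTop atTop) :
    Tendsto (fun α => ((Real.logb 3 (a (α+1)) : ℝ) : AddCircle (1:ℝ)) - (Real.logb 3 (a α) : ℝ))
      atTop (𝓝 ((-Real.logb 3 2 : ℝ) : AddCircle (1:ℝ))) := by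
  let f : ℕ → ℝ := fun n => if n % 2 = 1 then Real.logb 3 (1 + 1 / (3 * (n:ℝ))) else 0
  have hf : Tendsto f atTop (𝓝 0) := by
    apply Tendsto.if'
    · have h1 : Tendsto (fun n : ℕ => 1 + 1 / (3 * (n:ℝ))) atTop (𝓝 (1 + 0)) := by
        apply Tendsto.const_add
        apply Tendsto.const_div_atTop
        exact tendsto_natCast_atTop_atTop.const_mul_atTop (by norm_num)
      have h2 : Tendsto (Real.logb 3) (𝓝 (1 + 0)) (𝓝 0) := by
        have : ContinuousAt (Real.logb 3) 1 := by
          unfold Real.logb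
          exact (Real.continuousAt_log (by norm_num)).div_const _
        simpa [ContinuousAt] using this
      exact h2.comp h1
    · exact tendsto_const_nhds
  have key : ∀ α, ((Real.logb 3 (a (α+1)) : ℝ) : AddCircle (1:ℝ)) - (Real.logb 3 (a α) : ℝ)
      = ((-Real.logb 3 2 + f (a α) : ℝ) : AddCircle (1:ℝ)) := by
    intro α
    have hp : (0:ℝ) < a α := by exact_mod_cast hpos α
    rw [hrec]
    by_cases h : a α % 2 = 1
    · have e1 : (col2 (a α) : ℝ) = 3 * a α * (1 + 1 / (3 * (a α:ℝ))) / 2 := by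
        have : 2 * col2 (a α) = 3 * a α + 1 := by
          unfold col2; rw [if_pos h]; omega
        have : (2:ℝ) * col2 (a α) = 3 * a α + 1 := by exact_mod_cast this
        field_simp
        linarith
      have e2 : Real.logb 3 (col2 (a α)) = 1 + (Real.logb 3 (a α) + (-Real.logb 3 2 + f (a α))) := by
        rw [e1, Real.logb_div (by positivity) (by norm_num), Real.logb_mul (by positivity) (by positivity),
          Real.logb_mul (by norm_num) hp.ne', Real.logb_self_eq_one (by norm_num)]
        simp only [f, if_pos h]; ring
      rw [e2, AddCircle.coe_add, AddCircle.coe_add, AddCircle.coe_period]; abel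
    · have e1 : (col2 (a α) : ℝ) = a α / 2 := by
        have : 2 * col2 (a α) = a α := by
          unfold col2; rw [if_neg h]; omega
        have : (2:ℝ) * col2 (a α) = a α := by exact_mod_cast this
        linarith
      have e2 : Real.logb 3 (col2 (a α)) = (Real.logb 3 (a α) + (-Real.logb 3 2 + f (a α))) := by
        rw [e1, Real.logb_div hp.ne' (by norm_num)]
        simp only [f, if_neg h]; ring
      rw [e2, AddCircle.coe_add]; abel
  simp_rw [key]
  have h3 : Tendsto (fun α => -Real.logb 3 2 + f (a α)) atTop (𝓝 (-Real.logb 3 2)) := by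
    simpa using (hf.comp hinf).const_add (-Real.logb 3 2)
  exact ((AddCircle.continuous_mk' (1:ℝ)).tendsto _).comp h3

lemma irr_logb : Irrational (Real.logb 3 2) := by
  rintro ⟨q, hq⟩
  have hqpos : 0 < q := by
    have : (0:ℝ) < q := by rw [hq]; exact Real.logb_pos (by norm_num) (by norm_num)
    exact_mod_cast this
  have h1 : (3:ℝ) ^ (q:ℝ) = 2 := by rw [hq]; exact Real.rpow_logb (by norm_num) (by norm_num) (by norm_num)
  have hn : ((q.num.toNat : ℕ) : ℝ) = q * q.den := by
    have h2 : (q.num.toNat : ℤ) = q.num := Int.toNat_of_nonneg (Rat.num_pos.2 hqpos).le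
    have h3 : ((q.num.toNat : ℕ) : ℚ) = q * q.den := by
      rw [Rat.mul_den_eq_num]; exact_mod_cast h2
    exact_mod_cast h3
  have h4 : (3:ℝ) ^ q.num.toNat = 2 ^ q.den := by
    rw [← Real.rpow_natCast, hn, Real.rpow_mul (by norm_num), h1, Real.rpow_natCast]
  have h5 : 3 ^ q.num.toNat = 2 ^ q.den := by exact_mod_cast h4
  have h6 : 2 ∣ 3 ^ q.num.toNat := h5 ▸ dvd_pow_self 2 q.den_nz
  have := Nat.prime_two.dvd_of_dvd_pow h6
  omega

lemma prec3_of (φ θ : ℕ) (hφ : 1 ≤ φ) (hθ : 1 ≤ θ) (t : ℝ) (k : ℤ)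
    (h1 : Real.logb 3 φ < t) (h2 : t < Real.logb 3 (φ + 1)) (h : Real.logb 3 θ = t + k) :
    prec3 φ θ := by
  have hφ' : (0:ℝ) < φ := by exact_mod_cast hφ
  have hθ' : (0:ℝ) < θ := by exact_mod_cast hθ
  have hp : ⌊Real.logb 3 φ⌋ = ⌊t⌋ := by
    symm
    rw [Int.floor_eq_iff]
    refine ⟨(Int.floor_le _).trans h1.le, h2.trans_le ?_⟩
    have e : ⌊Real.logb ((3:ℕ):ℝ) φ⌋ = Int.log 3 (φ:ℝ) := Real.floor_logb_natCast hφ'.le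
    rw [Int.log_natCast] at e
    have e' : ⌊Real.logb 3 φ⌋ = (Nat.log 3 φ : ℤ) := by exact_mod_cast e
    rw [e', Real.logb_le_iff_le_rpow (by norm_num) (by positivity)]
    have := Nat.lt_pow_succ_log_self (b := 3) (by norm_num) φ
    have h3 : φ + 1 ≤ 3 ^ (Nat.log 3 φ + 1) := this
    have h4 : ((φ:ℝ) + 1) ≤ 3 ^ (Nat.log 3 φ + 1) := by exact_mod_cast h3
    rw [← Real.rpow_natCast] at h4
    exact_mod_cast h4
  have hq : ⌊Real.logb 3 θ⌋ = ⌊t⌋ + k := by rw [h, Int.floor_add_intCast]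
  unfold prec3
  change _ = ⌊(3:ℝ) ^ (⌊Real.logb 3 φ⌋ - ⌊Real.logb 3 θ⌋) * θ⌋
  rw [hp, hq, show ⌊t⌋ - (⌊t⌋ + k) = -k by ring]
  have e : (3:ℝ) ^ (-k) * θ = 3 ^ t := by
    rw [← Real.rpow_logb (b := 3) (x := θ) (by norm_num) (by norm_num) hθ', h,
      ← Real.rpow_intCast, ← Real.rpow_add (by norm_num)]
    congr 1; push_cast; ring
  rw [e]; symm; rw [Int.floor_eq_iff]
  rw [Real.logb_lt_iff_lt_rpow (by norm_num) hφ'] at h1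
  rw [Real.lt_logb_iff_rpow_lt (by norm_num) (by positivity)] at h2
  exact ⟨by exact_mod_cast h1.le, by exact_mod_cast h2⟩

open Filter Topology in
lemma exists_hit (a : ℕ → ℕ) (hpos : ∀ n, 1 ≤ a n)
    (hrec : ∀ α : ℕ, a (α + 1) = col2 (a α))
    (hinf : Tendsto a atTop atTop) (φ : ℕ) (hφ : 1 ≤ φ) (M : ℕ) :
    ∃ α, M < α ∧ prec3 φ (a α) := by
  have hstep := tendsto_step a hpos hrec hinf
  let y : ℕ → AddCircle (1:ℝ) := fun α => (Real.logb 3 (a α) : ℝ)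
  let c : AddCircle (1:ℝ) := ((-Real.logb 3 2 : ℝ) : AddCircle (1:ℝ))
  have hn : ∀ n : ℕ, Tendsto (fun α => y (α + n) - y α) atTop (𝓝 (n • c)) := by
    intro n
    induction n with
    | zero => simp
    | succ n ih =>
      have h1 : Tendsto (fun α => y (α + n + 1) - y (α + n)) atTop (𝓝 c) :=
        hstep.comp (tendsto_add_atTop_nat n)
      have h2 := ih.add h1
      rw [succ_nsmul]
      refine h2.congr fun α => ?_
      rw [← add_assoc]; abel
  have : Fact ((0:ℝ) < 1) := ⟨one_pos⟩
  obtain ⟨x, hx⟩ := exists_clusterPt_of_compactSpace (map y atTop)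
  obtain ⟨U, hU, hyU⟩ := mapClusterPt_iff_ultrafilter.1 hx
  have hd : DenseRange (· • c : ℕ → AddCircle (1:ℝ)) := by
    rw [← denseRange_zsmul_iff_nsmul]
    exact AddCircle.denseRange_zsmul_coe_iff.2 (by simpa using irr_logb)
  have hφ' : (0:ℝ) < φ := by exact_mod_cast hφ
  have huv : Real.logb 3 φ < Real.logb 3 (φ + 1) :=
    Real.logb_lt_logb (by norm_num) hφ' (by linarith)
  let V : Set (AddCircle (1:ℝ)) := (fun t : ℝ => (t : AddCircle (1:ℝ))) '' Set.Ioo (Real.logb 3 φ) (Real.logb 3 (φ+1))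
  have hV : IsOpen V := QuotientAddGroup.isOpenMap_coe _ isOpen_Ioo
  obtain ⟨t0, ht0⟩ := Set.nonempty_Ioo.2 huv
  obtain ⟨n, hnV⟩ := hd.exists_mem_open (hV.preimage (continuous_const_add x))
    ⟨-x + (t0 : AddCircle (1:ℝ)), by simpa using ⟨t0, ht0, rfl⟩⟩
  have hlim : Tendsto (fun α => y (α + n)) U (𝓝 (x + n • c)) := by
    refine (hyU.add ((hn n).mono_left hU)).congr fun α => ?_
    abel
  have hev := hlim.eventually (hV.mem_nhds hnV)
  obtain ⟨α, ⟨t, ht, hty⟩, hα⟩ := (hev.and (hU (eventually_gt_atTop M))).exists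
  refine ⟨α + n, by change M < α at hα; omega, ?_⟩
  have h0 : ((Real.logb 3 (a (α+n)) : ℝ) : AddCircle (1:ℝ)) = (t : ℝ) := hty.symm
  obtain ⟨k, hk⟩ : ∃ k : ℤ, Real.logb 3 (a (α+n)) = t + k := by
    rw [← sub_eq_zero, ← AddCircle.coe_sub, AddCircle.coe_eq_zero_iff] at h0
    obtain ⟨k, hk⟩ := h0
    refine ⟨k, ?_⟩
    simp at hk
    linarith
  exact prec3_of φ _ hφ (hpos _) t k ht.1 ht.2 hk

theorem exists_prec3_increasing_subsequence (a : ℕ → ℕ) (ha0 : 1 ≤ a 0)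
    (hrec : ∀ α : ℕ, a (α + 1) = col2 (a α))
    (hinf : Filter.Tendsto a Filter.atTop Filter.atTop)
    (φ : ℕ) (hφ : 1 ≤ φ) :
    ∃ α : ℕ → ℕ, StrictMono α ∧ prec3 φ (a (α 0)) ∧
      ∀ i : ℕ, prec3 (a (α i)) (a (α (i + 1))) := by
  have hpos : ∀ n, 1 ≤ a n := by
    intro n
    induction n with
    | zero => exact ha0
    | succ n ih => rw [hrec]; unfold col2; split_ifs <;> omega
  choose g hg1 hg2 using fun (m : ℕ) =>
    exists_hit a hpos hrec hinf (a m) (hpos m) m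
  obtain ⟨s, -, hs⟩ := exists_hit a hpos hrec hinf φ hφ 0
  refine ⟨fun i => g^[i] s, strictMono_nat_of_lt_succ fun i => ?_, hs, fun i => ?_⟩
  · rw [Function.iterate_succ_apply']; exact hg1 _
  · beta_reduce; rw [Function.iterate_succ_apply']; exact hg2 _
end
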